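/- In any execution of the AGS coding scheme Π (Algorithms 3–4) on inputs (x,y) with an arbitrary erasure pattern, for every round i with 1 ≤ i ≤ t_A+1, one of the following two conditions holds: (1) r_B(i) = r_A(i) and T^B(i) = T^A(i); or (2) r_B(i) = r_A(i)+1 and T^B(i) = T^A(i)∘π(x|T^A(i))∘π(y|T^A(i)∘π(x|T^A(i))). Furthermore, in either case, T^A(i) and T^B(i) are prefixes of the noiseless transcript T^π. -/

import Mathlib

/-!
Model of the AGS coding scheme Π (Algorithms 3–4) of "Interactive coding resilient to
an unknown number of erasures".  A noiseless alternating binary protocol `π` of length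
`N` is given by next-bit functions `fA fB : List Bool → Bool` (`fA t = π(x∣t)` on
even-length transcripts, `fB t = π(y∣t)` on odd-length transcripts).
Rounds are 1-indexed; round `i` consists of two timesteps whose erasures are given by
`(E i).1` (odd timestep, Alice → Bob) and `(E i).2` (even timestep, Bob → Alice).
In each timestep the sender either transmits a symbol `(b, ρ) ∈ {0,1}×{0,1}` or stays
silent (`□`); a reception is `none` (= the erasure mark ⊥) or `some` of a symbol.
-/

namespace AGS

/-- A transmitted symbol: a message `(bit, parity)`, or silence `□`. -/
inductive Sym where
  | msg : Bool → Bool → Sym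
  | sil : Sym
deriving DecidableEq

/-- The word (information-bit content) of a symbol: one bit for a message, the empty
word for silence. -/
def symWord : Sym → List Bool
  | Sym.msg b _ => [b]
  | Sym.sil => []

/-- Parity of a round number, as a Boolean. -/
def par (r : ℕ) : Bool := decide (r % 2 = 1)

/-- Joint state at the beginning of a round: Alice's transcript `TA`, counter `rA`,
flag `abot` (her last reception was ⊥); Bob's transcript `TB`, counter `rB`, and
stored bit `bsend`. -/
structure St where
  TA : List Bool
  rA : ℕ
  abot : Bool
  TB : List Bool
  rB : ℕ
  bsend : Bool
deriving DecidableEq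

/-- The initial state. -/
def init : St := ⟨[], 0, false, [], 0, false⟩

/-- The symbol Alice sends in the odd timestep of a round (silence if her last
reception was erased, and implicit silence after she has terminated). -/
def sentA (fA : List Bool → Bool) (N : ℕ) (s : St) : Sym :=
  if s.rA < N / 2 then
    if s.abot then Sym.sil else Sym.msg (fA s.TA) (par (s.rA + 1))
  else Sym.sil

/-- Bob's reception in the odd timestep (`none` = erasure mark ⊥). -/
def recvB (fA : List Bool → Bool) (N : ℕ) (e1 : Bool) (s : St) : Option Sym :=
  if e1 then none else some (sentA fA N s)

/-- Bob's update of `TB, rB, bsend` in the odd timestep, given his reception. -/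
def bobUpd (fB : List Bool → Bool) (N : ℕ) (r : Option Sym) (s : St) : St :=
  if s.rB < N / 2 then
    match r with
    | some (Sym.msg b p) =>
        if p = par (s.rB + 1) then
          { s with rB := s.rB + 1, bsend := fB (s.TB ++ [b]),
                   TB := (s.TB ++ [b]) ++ [fB (s.TB ++ [b])] }
        else s
    | _ => s
  else s

/-- The symbol Bob sends in the even timestep of a round, given the erasure `e1` of
the odd timestep and the state `s` at the beginning of the round.  In the normal
phase (`rB < N/2`) he answers any non-⊥ reception with his (possibly just updated)
stored message and is silent upon ⊥; in the termination phase (`rB = N/2`) he answers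
only a non-silent message of matching parity, and is silent otherwise. -/
def sentB (fA fB : List Bool → Bool) (N : ℕ) (e1 : Bool) (s : St) : Sym :=
  let r := recvB fA N e1 s
  if s.rB < N / 2 then
    match r with
    | none => Sym.sil
    | some _ =>
        let s' := bobUpd fB N r s
        Sym.msg s'.bsend (par s'.rB)
  else
    match r with
    | some (Sym.msg _ p) => if p = par s.rB then Sym.msg s.bsend (par s.rB) else Sym.sil
    | _ => Sym.sil

/-- One round of the AGS coding scheme.  After Alice terminates (`rA = N/2`) her part
of the state is frozen and only Bob's part evolves (he keeps receiving silence, unless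
erased). -/
def step (fA fB : List Bool → Bool) (N : ℕ) (e : Bool × Bool) (s : St) : St :=
  let r := recvB fA N e.1 s
  let sB := bobUpd fB N r s
  if s.rA < N / 2 then
    let mB := sentB fA fB N e.1 s
    let rcvA : Option Sym := if e.2 then none else some mB
    match rcvA with
    | none => { sB with rA := s.rA, abot := true }
    | some (Sym.msg b p) =>
        if p = par (s.rA + 1) then
          { sB with TA := (s.TA ++ [fA s.TA]) ++ [b], rA := s.rA + 1, abot := false }
        else { sB with rA := s.rA, abot := false }
    | some Sym.sil => { sB with rA := s.rA, abot := false }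
  else sB

/-- `exec fA fB N E k` is the state after `k` rounds have been played. -/
def exec (fA fB : List Bool → Bool) (N : ℕ) (E : ℕ → Bool × Bool) : ℕ → St
  | 0 => init
  | k + 1 => step fA fB N (E (k + 1)) (exec fA fB N E k)

/-- `stAt fA fB N E i` is the state at the beginning of round `i` (rounds 1-indexed):
for a protocol variable `v`, `v(i) = (stAt … i).v`. -/
def stAt (fA fB : List Bool → Bool) (N : ℕ) (E : ℕ → Bool × Bool) (i : ℕ) : St :=
  exec fA fB N E (i - 1)

/-- The noiseless transcript of `π` after `r` rounds; `transcript fA fB (N/2)` is `T^π`. -/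
def transcript (fA fB : List Bool → Bool) : ℕ → List Bool
  | 0 => []
  | r + 1 =>
    let t := transcript fA fB r
    (t ++ [fA t]) ++ [fB (t ++ [fA t])]

/-- `cA … i` : the number of rounds `j < i` in which Alice sent a non-silent message. -/
def cA (fA fB : List Bool → Bool) (N : ℕ) (E : ℕ → Bool × Bool) (i : ℕ) : ℕ :=
  ((Finset.Ico 1 i).filter fun j => sentA fA N (stAt fA fB N E j) ≠ Sym.sil).card

/-- `cB … i` : the number of rounds `j < i` in which Bob sent a non-silent message. -/
def cB (fA fB : List Bool → Bool) (N : ℕ) (E : ℕ → Bool × Bool) (i : ℕ) : ℕ :=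
  ((Finset.Ico 1 i).filter fun j =>
    sentB fA fB N (E j).1 (stAt fA fB N E j) ≠ Sym.sil).card

/-- `cch … i` : the total number of ⊥ receptions of Bob and of Alice in the rounds
before round `i` (Alice receives only while she is active). -/
def cch (fA fB : List Bool → Bool) (N : ℕ) (E : ℕ → Bool × Bool) (i : ℕ) : ℕ :=
  ((Finset.Ico 1 i).filter fun j => (E j).1 = true).card +
  ((Finset.Ico 1 i).filter fun j =>
    (E j).2 = true ∧ (stAt fA fB N E j).rA < N / 2).card

/-- The invariant of the execution: Alice holds the first `rA` rounds of the noiseless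
transcript, and Bob holds either the same rounds or exactly one more, in which case his
stored bit is his answer in that additional round. -/
structure Synced (fA fB : List Bool → Bool) (N : ℕ) (s : St) : Prop where
  rA_le : s.rA ≤ N / 2
  TA_eq : s.TA = transcript fA fB s.rA
  bob : (s.rB = s.rA ∧ s.TB = transcript fA fB s.rA) ∨
    (s.rB = s.rA + 1 ∧ s.rA < N / 2 ∧ s.TB = transcript fA fB (s.rA + 1) ∧
      s.bsend = fB (transcript fA fB s.rA ++ [fA (transcript fA fB s.rA)]))

theorem par_ne_par_succ (r : ℕ) : par r ≠ par (r + 1) := by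
  simp only [par, ne_eq, decide_eq_decide]
  omega

theorem synced_init (fA fB : List Bool → Bool) (N : ℕ) : Synced fA fB N init :=
  ⟨Nat.zero_le _, rfl, Or.inl ⟨rfl, rfl⟩⟩

theorem Synced.step {fA fB : List Bool → Bool} {N : ℕ} {s : St}
    (h : Synced fA fB N s) (e : Bool × Bool) : Synced fA fB N (step fA fB N e s) := by
  obtain ⟨e₁, e₂⟩ := e
  obtain ⟨TA, rA, abot, TB, rB, bsend⟩ := s
  obtain ⟨hle, hTA, hbob⟩ := h
  dsimp only at hle hTA hbob
  have h₁ := par_ne_par_succ rA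
  have h₂ := par_ne_par_succ (rA + 1)
  by_cases hlt : rA < N / 2
  · rcases hbob with ⟨rfl, rfl⟩ | ⟨rfl, -, rfl, rfl⟩
    · subst hTA
      cases e₁ <;> cases e₂ <;> cases abot <;> constructor <;>
        simp [AGS.step, recvB, sentA, bobUpd, sentB, transcript, hlt, h₁, hle]
    · subst hTA
      by_cases hlt' : rA + 1 < N / 2 <;>
      cases e₁ <;> cases e₂ <;> cases abot <;> constructor <;>
        simp [AGS.step, recvB, sentA, bobUpd, sentB, transcript, hlt, hlt', h₂, hle]
  · have hB : ¬ rB < N / 2 := by omega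
    have hstep : AGS.step fA fB N (e₁, e₂) ⟨TA, rA, abot, TB, rB, bsend⟩ =
        ⟨TA, rA, abot, TB, rB, bsend⟩ := by
      simp [AGS.step, bobUpd, hlt, hB]
    rw [hstep]
    exact ⟨hle, hTA, hbob⟩

theorem synced_exec (fA fB : List Bool → Bool) (N : ℕ) (E : ℕ → Bool × Bool) (k : ℕ) :
    Synced fA fB N (exec fA fB N E k) := by
  induction k with
  | zero => exact synced_init fA fB N
  | succ k ih => exact ih.step _

theorem transcript_prefix (fA fB : List Bool → Bool) {m n : ℕ} (h : m ≤ n) :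
    transcript fA fB m <+: transcript fA fB n := by
  induction n, h using Nat.le_induction with
  | base => exact List.prefix_rfl
  | succ n _ ih =>
    exact ih.trans ((List.prefix_append _ _).trans (List.prefix_append _ _))

/-- Lemma 13 of the paper.  In any execution of the AGS scheme, for
every round `1 ≤ i ≤ t_A + 1`, either `r_B(i) = r_A(i)` and `T^B(i) = T^A(i)`, or
`r_B(i) = r_A(i)+1` and `T^B(i) = T^A(i)∘π(x∣T^A(i))∘π(y∣T^A(i)∘π(x∣T^A(i)))`;
in either case both partial transcripts are prefixes of `T^π`. -/
theorem ags_shift_sync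
    (fA fB : List Bool → Bool) (N : ℕ) (hN : 0 < N) (hNeven : Even N)
    (E : ℕ → Bool × Bool) (tA : ℕ)
    (htA1 : ∀ i, 1 ≤ i → i ≤ tA → (stAt fA fB N E i).rA < N / 2)
    (htA2 : (stAt fA fB N E (tA + 1)).rA = N / 2)
    (i : ℕ) (hi1 : 1 ≤ i) (hi2 : i ≤ tA + 1)
    (s : St) (hs : s = stAt fA fB N E i) :
    ((s.rB = s.rA ∧ s.TB = s.TA) ∨
      (s.rB = s.rA + 1 ∧
        s.TB = (s.TA ++ [fA s.TA]) ++ [fB (s.TA ++ [fA s.TA])])) ∧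
    s.TA <+: transcript fA fB (N / 2) ∧
    s.TB <+: transcript fA fB (N / 2) := by
  obtain ⟨hle, hTA, hbob⟩ : Synced fA fB N s := hs ▸ synced_exec fA fB N E (i - 1)
  refine ⟨?_, hTA ▸ transcript_prefix fA fB hle, ?_⟩
  · rcases hbob with ⟨hr, hT⟩ | ⟨hr, -, hT, -⟩
    · exact Or.inl ⟨hr, hT.trans hTA.symm⟩
    · exact Or.inr ⟨hr, by rw [hT, hTA]; rfl⟩
  · rcases hbob with ⟨-, hT⟩ | ⟨-, hlt, hT, -⟩
    · exact hT ▸ transcript_prefix fA fB hle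
    · exact hT ▸ transcript_prefix fA fB hlt

end AGS
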